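/- arXiv:1806.08306 — 2 statements merged into one kernel-verified Lean document; each statement's English description precedes it below -/
import Mathlib

section
/- Let Π be a set partition of [k] and let Λ be a composition of k+1 with shape(Π) → Λ. Then there exists a unique set partition Θ of [k+1] such that Θ^- = Π and shape(Θ) = Λ. -/
/-- `P` is a set partition of `[k] = {1,…,k}`: its blocks are nonempty,
pairwise disjoint, and their union is `{1,…,k}`. -/
def IsSetPartition (k : ℕ) (P : Finset (Finset ℕ)) : Prop :=
  (∀ b ∈ P, b.Nonempty) ∧
    (∀ b ∈ P, ∀ c ∈ P, b ≠ c → Disjoint b c) ∧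
    P.sup id = Finset.Icc 1 k

/-- The shape of a set partition: the list of block sizes, blocks being listed
increasingly according to their largest element (normal ordering). -/
def shape (P : Finset (Finset ℕ)) : List ℕ :=
  (List.range ((P.sup fun b => b.sup id) + 1)).filterMap fun m =>
    let c := P.sup fun b => if m ∈ b ∧ ∀ x ∈ b, x ≤ m then b.card else 0
    if c = 0 then none else some c

/-- `Π⁻`: decrease every element of every block by `1`, delete the resulting
`0` from its block, and delete the block if it becomes empty. -/
def pminus (P : Finset (Finset ℕ)) : Finset (Finset ℕ) :=
  (P.image fun b => (b.image fun x => x - 1).erase 0).filter fun b => b.Nonempty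

/-- One-step relation on compositions (as lists of positive integers):
`λ → Λ` iff `Λ` is obtained from `λ` by increasing exactly one entry by `1`,
or by prepending a new first entry equal to `1`. -/
def Step (lam Lam : List ℕ) : Prop :=
  Lam = 1 :: lam ∨ ∃ j : Fin lam.length, Lam = lam.set j (lam.get j + 1)

/-- The nonzero values of `c` along the list `l`, in order. -/
def nonzeroValues (l : List ℕ) (c : ℕ → ℕ) : List ℕ :=
  l.filterMap fun m => if c m = 0 then none else some (c m)

/-- `m` is the largest element of `b`. -/
def IsMaxOf (b : Finset ℕ) (m : ℕ) : Prop := m ∈ b ∧ ∀ x ∈ b, x ≤ m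

instance (b : Finset ℕ) (m : ℕ) : Decidable (IsMaxOf b m) :=
  inferInstanceAs (Decidable (_ ∧ _))

/-- The size of the block of `P` with largest element `m`, or `0` if there is none. -/
def sizeAt (P : Finset (Finset ℕ)) (m : ℕ) : ℕ :=
  P.sup fun b => if m ∈ b ∧ ∀ x ∈ b, x ≤ m then b.card else 0

/-- Increase every element of a block by `1`. -/
def shiftUp (b : Finset ℕ) : Finset ℕ := b.image (· + 1)

/-- Decrease every element of a block by `1` and delete `0`. -/
def shiftDown (b : Finset ℕ) : Finset ℕ := (b.image fun x => x - 1).erase 0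

/-- Shift the blocks of `P` up by `1` and put `1` into the block coming from `b`;
for `b = ∅`, the new element forms a block of its own. -/
def extend (P : Finset (Finset ℕ)) (b : Finset ℕ) : Finset (Finset ℕ) :=
  insert (insert 1 (shiftUp b)) ((P.erase b).image shiftUp)

section NonzeroValues

theorem nonzeroValues_cons (a : ℕ) (l : List ℕ) (c : ℕ → ℕ) :
    nonzeroValues (a :: l) c =
      if c a = 0 then nonzeroValues l c else c a :: nonzeroValues l c := by
  unfold nonzeroValues
  by_cases h : c a = 0 <;> simp [h]

theorem nonzeroValues_map (f : ℕ → ℕ) (l : List ℕ) (c : ℕ → ℕ) :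
    nonzeroValues (l.map f) c = nonzeroValues l fun m => c (f m) := by
  simp only [nonzeroValues, List.filterMap_map]
  rfl

theorem nonzeroValues_congr {l : List ℕ} {c d : ℕ → ℕ} (h : ∀ m ∈ l, c m = d m) :
    nonzeroValues l c = nonzeroValues l d := by
  refine List.filterMap_congr fun m hm => ?_
  rw [h m hm]

theorem length_nonzeroValues_congr {l : List ℕ} {c d : ℕ → ℕ}
    (h : ∀ m ∈ l, (c m = 0 ↔ d m = 0)) :
    (nonzeroValues l c).length = (nonzeroValues l d).length := by
  induction l with
  | nil => rfl
  | cons a l ih =>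
    have ih := ih fun m hm => h m (List.mem_cons_of_mem _ hm)
    have ha := h a List.mem_cons_self
    rw [nonzeroValues_cons, nonzeroValues_cons]
    by_cases hc : c a = 0
    · rw [if_pos hc, if_pos (ha.1 hc), ih]
    · rw [if_neg hc, if_neg (fun hd => hc (ha.2 hd)), List.length_cons, List.length_cons, ih]

theorem eq_of_nonzeroValues_eq {l : List ℕ} {c d : ℕ → ℕ}
    (h : ∀ m ∈ l, (c m = 0 ↔ d m = 0)) (heq : nonzeroValues l c = nonzeroValues l d) :
    ∀ m ∈ l, c m = d m := by
  induction l with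
  | nil => simp
  | cons a l ih =>
    have ih := ih fun m hm => h m (List.mem_cons_of_mem _ hm)
    have ha := h a List.mem_cons_self
    rw [nonzeroValues_cons, nonzeroValues_cons] at heq
    by_cases hc : c a = 0
    · rw [if_pos hc, if_pos (ha.1 hc)] at heq
      simpa [hc, ha.1 hc] using ih heq
    · rw [if_neg hc, if_neg (fun hd => hc (ha.2 hd)), List.cons.injEq] at heq
      simpa [heq.1] using ih heq.2

theorem exists_nonzeroValues_eq_set {l : List ℕ} (hl : l.Nodup) (c : ℕ → ℕ) (j : ℕ)
    (hj : j < (nonzeroValues l c).length) :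
    ∃ m ∈ l, c m ≠ 0 ∧ nonzeroValues l (fun x => c x + if x = m then 1 else 0) =
      (nonzeroValues l c).set j ((nonzeroValues l c)[j] + 1) := by
  induction l generalizing j with
  | nil => simp [nonzeroValues] at hj
  | cons a l ih =>
    obtain ⟨hal, hl⟩ := List.nodup_cons.1 hl
    by_cases hc : c a = 0
    · have hcons := nonzeroValues_cons a l c
      rw [if_pos hc] at hcons
      simp only [hcons] at hj ⊢
      obtain ⟨m, hm, hcm, h⟩ := ih hl j hj
      refine ⟨m, List.mem_cons_of_mem _ hm, hcm, ?_⟩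
      have ham : a ≠ m := fun h => hal (h ▸ hm)
      rw [nonzeroValues_cons, if_pos (by simp [hc, ham]), h]
    · have hcons := nonzeroValues_cons a l c
      rw [if_neg hc] at hcons
      simp only [hcons] at hj ⊢
      cases j with
      | zero =>
        refine ⟨a, List.mem_cons_self, hc, ?_⟩
        rw [nonzeroValues_cons, if_neg (by simp)]
        simp only [if_true, List.set_cons_zero, List.getElem_cons_zero]
        congr 1
        refine nonzeroValues_congr fun m hm => ?_
        have ham : m ≠ a := fun h => hal (h ▸ hm)
        simp [ham]
      | succ j =>
        obtain ⟨m, hm, hcm, h⟩ := ih hl j (by simpa using hj)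
        refine ⟨m, List.mem_cons_of_mem _ hm, hcm, ?_⟩
        have ham : a ≠ m := fun h => hal (h ▸ hm)
        rw [nonzeroValues_cons, if_neg (by simp [hc]), h]
        simp [ham]

end NonzeroValues

theorem mem_shiftUp {b : Finset ℕ} {x : ℕ} : x ∈ shiftUp b ↔ ∃ y ∈ b, y + 1 = x := by
  simp [shiftUp]

theorem succ_mem_shiftUp {b : Finset ℕ} {x : ℕ} : x + 1 ∈ shiftUp b ↔ x ∈ b := by
  simp [shiftUp]

theorem mem_shiftDown {b : Finset ℕ} {x : ℕ} : x ∈ shiftDown b ↔ x ≠ 0 ∧ x + 1 ∈ b := by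
  simp only [shiftDown, Finset.mem_erase, Finset.mem_image]
  constructor
  · rintro ⟨h, y, hy, rfl⟩
    exact ⟨h, by rwa [Nat.sub_add_cancel (by omega)]⟩
  · rintro ⟨h, hx⟩
    exact ⟨h, x + 1, hx, by omega⟩

theorem card_shiftUp (b : Finset ℕ) : (shiftUp b).card = b.card :=
  Finset.card_image_of_injective _ (add_left_injective 1)

theorem one_mem_shiftUp {b : Finset ℕ} (hb : 0 ∉ b) : 1 ∉ shiftUp b := by
  rwa [← zero_add 1, succ_mem_shiftUp]

theorem shiftDown_shiftUp {b : Finset ℕ} (hb : 0 ∉ b) : shiftDown (shiftUp b) = b := by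
  ext x
  rw [mem_shiftDown, succ_mem_shiftUp]
  exact ⟨And.right, fun h => ⟨fun h0 => hb (h0 ▸ h), h⟩⟩

theorem shiftDown_insert_one (b : Finset ℕ) : shiftDown (insert 1 b) = shiftDown b := by
  ext x
  simp only [mem_shiftDown, Finset.mem_insert]
  grind

theorem shiftUp_shiftDown {b : Finset ℕ} (hb : 0 ∉ b) : shiftUp (shiftDown b) = b.erase 1 := by
  ext x
  simp only [mem_shiftUp, mem_shiftDown, Finset.mem_erase]
  constructor
  · rintro ⟨y, ⟨hy, hyb⟩, rfl⟩
    exact ⟨by omega, hyb⟩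
  · rintro ⟨hx, hxb⟩
    have : x ≠ 0 := fun h => hb (h ▸ hxb)
    exact ⟨x - 1, ⟨by omega, by rwa [Nat.sub_add_cancel (by omega)]⟩, by omega⟩

theorem mem_pminus {P : Finset (Finset ℕ)} {b : Finset ℕ} :
    b ∈ pminus P ↔ (∃ c ∈ P, shiftDown c = b) ∧ b.Nonempty := by
  simp [pminus, shiftDown]

theorem mem_extend {P : Finset (Finset ℕ)} {b B : Finset ℕ} :
    B ∈ extend P b ↔ B = insert 1 (shiftUp b) ∨ ∃ c ∈ P, c ≠ b ∧ shiftUp c = B := by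
  simp only [extend, Finset.mem_insert, Finset.mem_image, Finset.mem_erase]
  grind

namespace IsSetPartition

variable {k : ℕ} {P : Finset (Finset ℕ)}

theorem exists_mem_iff (h : IsSetPartition k P) {x : ℕ} :
    (∃ b ∈ P, x ∈ b) ↔ 1 ≤ x ∧ x ≤ k := by
  rw [← Finset.mem_Icc, ← h.2.2, Finset.mem_sup]
  rfl

theorem eq_of_mem (h : IsSetPartition k P) {b c : Finset ℕ} (hb : b ∈ P) (hc : c ∈ P) {x : ℕ}
    (hxb : x ∈ b) (hxc : x ∈ c) : b = c := by
  by_contra hne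
  exact Finset.disjoint_left.1 (h.2.1 b hb c hc hne) hxb hxc

theorem zero_notMem (h : IsSetPartition k P) {b : Finset ℕ} (hb : b ∈ P) : 0 ∉ b := by
  intro h0
  have := h.exists_mem_iff.1 ⟨b, hb, h0⟩
  omega

theorem zero_notMem_of_mem_or_eq_empty (h : IsSetPartition k P) {b : Finset ℕ}
    (hb : b ∈ P ∨ b = ∅) : 0 ∉ b := by
  rcases hb with hb | rfl
  · exact h.zero_notMem hb
  · simp

theorem sizeAt_eq_card (h : IsSetPartition k P) {b : Finset ℕ} (hb : b ∈ P) {m : ℕ}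
    (hm : IsMaxOf b m) : sizeAt P m = b.card := by
  refine le_antisymm (Finset.sup_le fun c hc => ?_) ?_
  · split_ifs with hcm
    · rw [h.eq_of_mem hb hc hm.1 hcm.1]
    · exact Nat.zero_le _
  · refine le_trans (le_of_eq ?_) (Finset.le_sup hb)
    exact (if_pos hm).symm

end IsSetPartition

theorem sizeAt_eq_zero {P : Finset (Finset ℕ)} {m : ℕ} (h : ∀ b ∈ P, ¬ IsMaxOf b m) :
    sizeAt P m = 0 :=
  Nat.le_zero.1 <| Finset.sup_le fun b hb => (if_neg (h b hb)).le

theorem exists_isMaxOf_of_sizeAt_ne_zero {P : Finset (Finset ℕ)} {m : ℕ} (h : sizeAt P m ≠ 0) :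
    ∃ b ∈ P, IsMaxOf b m := by
  by_contra! hn
  exact h (sizeAt_eq_zero hn)

namespace IsSetPartition

variable {k : ℕ} {P : Finset (Finset ℕ)} {b : Finset ℕ}

theorem sizeAt_zero (h : IsSetPartition k P) : sizeAt P 0 = 0 :=
  sizeAt_eq_zero fun _ hb hm => h.zero_notMem hb hm.1

theorem shape_eq (h : IsSetPartition k P) :
    shape P = nonzeroValues (List.range (k + 1)) (sizeAt P) := by
  have hsup : (P.sup fun b => b.sup id) = k := by
    refine le_antisymm
      (Finset.sup_le fun b hb => Finset.sup_le fun x hx => (h.exists_mem_iff.1 ⟨b, hb, hx⟩).2) ?_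
    rcases Nat.eq_zero_or_pos k with rfl | hk
    · exact Nat.zero_le _
    · obtain ⟨b, hb, hkb⟩ := h.exists_mem_iff.2 ⟨hk, le_rfl⟩
      exact (Finset.le_sup (f := id) hkb).trans (Finset.le_sup (f := fun b => b.sup id) hb)
  simp only [shape, hsup]
  rfl

theorem exists_isMaxOf (h : IsSetPartition k P) (hb : b ∈ P) :
    ∃ m ∈ List.range (k + 1), IsMaxOf b m := by
  obtain ⟨m, hm, hmax⟩ := Finset.exists_max_image b id (h.1 b hb)
  have := (h.exists_mem_iff.1 ⟨b, hb, hm⟩).2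
  exact ⟨m, List.mem_range.2 (by omega), hm, hmax⟩

theorem extend (h : IsSetPartition k P) (hb : b ∈ P ∨ b = ∅) :
    IsSetPartition (k + 1) (extend P b) := by
  have hdisj : ∀ c ∈ P, c ≠ b → Disjoint (insert 1 (shiftUp b)) (shiftUp c) := by
    intro c hc hne
    refine Finset.disjoint_left.2 fun x hx hxc => ?_
    obtain ⟨y, hy, rfl⟩ := mem_shiftUp.1 hxc
    rcases Finset.mem_insert.1 hx with h1 | hx
    · exact h.zero_notMem hc ((Nat.succ_injective h1 : y = 0) ▸ hy)
    · rcases hb with hb | rfl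
      · exact hne (h.eq_of_mem hc hb hy (succ_mem_shiftUp.1 hx))
      · simp [shiftUp] at hx
  refine ⟨?_, ?_, ?_⟩
  · intro B hB
    rcases mem_extend.1 hB with rfl | ⟨c, hc, -, rfl⟩
    · exact Finset.insert_nonempty _ _
    · exact (h.1 c hc).image _
  · intro B hB C hC hne
    rcases mem_extend.1 hB with rfl | ⟨b', hb', hb'b, rfl⟩ <;>
      rcases mem_extend.1 hC with rfl | ⟨c', hc', hc'b, rfl⟩
    · exact absurd rfl hne
    · exact hdisj c' hc' hc'b
    · exact (hdisj b' hb' hb'b).symm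
    · refine Finset.disjoint_left.2 fun x hx hxc => hne ?_
      obtain ⟨y, hy, rfl⟩ := mem_shiftUp.1 hx
      rw [h.eq_of_mem hb' hc' hy (succ_mem_shiftUp.1 hxc)]
  · ext x
    rw [Finset.mem_sup, Finset.mem_Icc]
    constructor
    · rintro ⟨B, hB, hx⟩
      have key : ∀ c ∈ P, ∀ y ∈ shiftUp c, 1 ≤ y ∧ y ≤ k + 1 := by
        intro c hc y hy
        obtain ⟨z, hz, rfl⟩ := mem_shiftUp.1 hy
        have := h.exists_mem_iff.1 ⟨c, hc, hz⟩
        omega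
      rcases mem_extend.1 hB with rfl | ⟨c, hc, -, rfl⟩
      · rcases Finset.mem_insert.1 hx with rfl | hx
        · omega
        · rcases hb with hb | rfl
          · exact key b hb x hx
          · simp [shiftUp] at hx
      · exact key c hc x hx
    · rintro ⟨h1, h2⟩
      rcases Nat.eq_or_lt_of_le h1 with rfl | h1
      · exact ⟨_, mem_extend.2 (.inl rfl), Finset.mem_insert_self _ _⟩
      · obtain ⟨y, rfl⟩ : ∃ y, x = y + 1 := ⟨x - 1, by omega⟩
        obtain ⟨c, hc, hy⟩ := h.exists_mem_iff.2 (⟨by omega, by omega⟩ : 1 ≤ y ∧ y ≤ k)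
        by_cases hcb : c = b
        · subst hcb
          exact ⟨_, mem_extend.2 (.inl rfl), Finset.mem_insert_of_mem (succ_mem_shiftUp.2 hy)⟩
        · exact ⟨_, mem_extend.2 (.inr ⟨c, hc, hcb, rfl⟩), succ_mem_shiftUp.2 hy⟩

theorem pminus_extend (h : IsSetPartition k P) (hb : b ∈ P ∨ b = ∅) :
    pminus (_root_.extend P b) = P := by
  have hdown : shiftDown (insert 1 (shiftUp b)) = b := by
    rw [shiftDown_insert_one, shiftDown_shiftUp (h.zero_notMem_of_mem_or_eq_empty hb)]
  ext c
  rw [mem_pminus]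
  constructor
  · rintro ⟨⟨B, hB, rfl⟩, hne⟩
    rcases mem_extend.1 hB with rfl | ⟨c, hc, -, rfl⟩
    · rw [hdown] at hne ⊢
      exact hb.resolve_right hne.ne_empty
    · rwa [shiftDown_shiftUp (h.zero_notMem hc)]
  · intro hc
    refine ⟨?_, h.1 c hc⟩
    by_cases hcb : c = b
    · exact ⟨_, mem_extend.2 (.inl rfl), hdown.trans hcb.symm⟩
    · exact ⟨_, mem_extend.2 (.inr ⟨c, hc, hcb, rfl⟩), shiftDown_shiftUp (h.zero_notMem hc)⟩

theorem exists_eq_extend_pminus (h : IsSetPartition (k + 1) P) :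
    ∃ b, (b ∈ pminus P ∨ b = ∅) ∧ P = _root_.extend (pminus P) b := by
  obtain ⟨B, hB, h1⟩ := h.exists_mem_iff.2 (⟨le_rfl, by omega⟩ : 1 ≤ 1 ∧ 1 ≤ k + 1)
  have hB' : insert 1 (shiftUp (shiftDown B)) = B := by
    rw [shiftUp_shiftDown (h.zero_notMem hB), Finset.insert_erase h1]
  have hup : ∀ C ∈ P, C ≠ B → shiftUp (shiftDown C) = C := by
    intro C hC hne
    rw [shiftUp_shiftDown (h.zero_notMem hC), Finset.erase_eq_of_notMem]
    exact fun h1C => hne (h.eq_of_mem hC hB h1C h1)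
  refine ⟨shiftDown B, ?_, ?_⟩
  · rw [or_comm, mem_pminus]
    exact (Finset.eq_empty_or_nonempty _).imp_right fun hne => ⟨⟨B, hB, rfl⟩, hne⟩
  · ext C
    rw [mem_extend, hB']
    constructor
    · intro hC
      refine or_iff_not_imp_left.2 fun hne => ⟨shiftDown C, ?_, ?_, hup C hC hne⟩
      · refine mem_pminus.2 ⟨⟨C, hC, rfl⟩, ?_⟩
        have hCne := h.1 C hC
        rw [← hup C hC hne] at hCne
        exact Finset.image_nonempty.1 hCne
      · intro heq
        obtain ⟨x, hx⟩ := h.1 C hC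
        refine hne (h.eq_of_mem hC hB hx ?_)
        rw [← hup C hC hne, heq] at hx
        rw [← hB']
        exact Finset.mem_insert_of_mem hx
    · rintro (rfl | ⟨c, hc, hne, rfl⟩)
      · exact hB
      · obtain ⟨⟨C, hC, rfl⟩, -⟩ := mem_pminus.1 hc
        rwa [hup C hC fun hCB => hne (hCB ▸ rfl)]

theorem sizeAt_extend_succ (h : IsSetPartition k P) (hb : b ∈ P ∨ b = ∅) {m : ℕ} (hm : m ≠ 0) :
    sizeAt (_root_.extend P b) (m + 1) = sizeAt P m + if IsMaxOf b m then 1 else 0 := by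
  have hup : ∀ {c : Finset ℕ}, IsMaxOf (shiftUp c) (m + 1) ↔ IsMaxOf c m := by
    intro c
    simp [IsMaxOf, shiftUp]
  have hins : IsMaxOf (insert 1 (shiftUp b)) (m + 1) ↔ IsMaxOf b m := by
    simp [IsMaxOf, shiftUp, hm]
  by_cases hex : ∃ c ∈ P, IsMaxOf c m
  · obtain ⟨c, hc, hcm⟩ := hex
    rw [h.sizeAt_eq_card hc hcm]
    by_cases hcb : c = b
    · subst hcb
      rw [if_pos hcm, (h.extend hb).sizeAt_eq_card (mem_extend.2 (.inl rfl)) (hins.2 hcm),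
        Finset.card_insert_of_notMem (one_mem_shiftUp (h.zero_notMem hc)), card_shiftUp]
    · have hbm : ¬ IsMaxOf b m := by
        rintro ⟨hmb, -⟩
        rcases hb with hb | rfl
        · exact hcb (h.eq_of_mem hc hb hcm.1 hmb)
        · simp at hmb
      rw [if_neg hbm, (h.extend hb).sizeAt_eq_card (mem_extend.2 (.inr ⟨c, hc, hcb, rfl⟩))
        (hup.2 hcm), card_shiftUp, add_zero]
  · have hbm : ¬ IsMaxOf b m := by
      intro hbm
      rcases hb with hb | rfl
      · exact hex ⟨b, hb, hbm⟩
      · simp [IsMaxOf] at hbm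
    rw [if_neg hbm, sizeAt_eq_zero fun c hc hcm => hex ⟨c, hc, hcm⟩, sizeAt_eq_zero]
    intro B hB hBm
    rcases mem_extend.1 hB with rfl | ⟨c, hc, -, rfl⟩
    · exact hbm (hins.1 hBm)
    · exact hex ⟨c, hc, hup.1 hBm⟩

theorem sizeAt_extend_one (h : IsSetPartition k P) (hb : b ∈ P) :
    sizeAt (_root_.extend P b) 1 = 0 := by
  refine sizeAt_eq_zero fun B hB hB1 => ?_
  have hup : ∀ c ∈ P, ∀ x ∈ shiftUp c, ¬ x ≤ 1 := by
    intro c hc x hx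
    obtain ⟨y, hy, rfl⟩ := mem_shiftUp.1 hx
    have := h.exists_mem_iff.1 ⟨c, hc, hy⟩
    omega
  rcases mem_extend.1 hB with rfl | ⟨c, hc, -, rfl⟩
  · obtain ⟨x, hx⟩ := (h.1 b hb).image (· + 1)
    exact hup b hb x hx (hB1.2 x (Finset.mem_insert_of_mem hx))
  · exact hup c hc 1 hB1.1 le_rfl

theorem shape_extend_empty (h : IsSetPartition k P) :
    shape (_root_.extend P ∅) = 1 :: shape P := by
  have hext := h.extend (.inr rfl)
  have h1 : sizeAt (_root_.extend P ∅) 1 = 1 :=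
    hext.sizeAt_eq_card (b := {1}) (mem_extend.2 (.inl rfl)) (by simp [IsMaxOf])
  rw [hext.shape_eq, h.shape_eq, List.range_succ_eq_map, nonzeroValues_cons,
    if_pos hext.sizeAt_zero, nonzeroValues_map, List.range_succ_eq_map, nonzeroValues_cons,
    nonzeroValues_cons, if_pos h.sizeAt_zero, if_neg (by simp [h1]), nonzeroValues_map,
    nonzeroValues_map]
  simp only [Nat.succ_eq_add_one, zero_add, h1, List.cons.injEq, true_and]
  refine nonzeroValues_congr fun m _ => ?_
  rw [h.sizeAt_extend_succ (.inr rfl) m.succ_ne_zero, if_neg (by simp [IsMaxOf]), add_zero]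

theorem shape_extend (h : IsSetPartition k P) (hb : b ∈ P) :
    shape (_root_.extend P b) =
      nonzeroValues (List.range (k + 1)) fun m => sizeAt P m + if IsMaxOf b m then 1 else 0 := by
  have hext := h.extend (.inl hb)
  rw [hext.shape_eq, List.range_succ_eq_map, nonzeroValues_cons, if_pos hext.sizeAt_zero,
    nonzeroValues_map]
  refine nonzeroValues_congr fun m _ => ?_
  rcases eq_or_ne m 0 with rfl | hm
  · rw [h.sizeAt_extend_one hb, h.sizeAt_zero, if_neg fun hm => h.zero_notMem hb hm.1]
  · exact h.sizeAt_extend_succ (.inl hb) hm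

theorem sizeAt_add_eq_zero_iff (h : IsSetPartition k P) (hb : b ∈ P) (m : ℕ) :
    (sizeAt P m + if IsMaxOf b m then 1 else 0) = 0 ↔ sizeAt P m = 0 := by
  by_cases hm : IsMaxOf b m
  · have := (h.1 b hb).card_pos
    rw [if_pos hm, h.sizeAt_eq_card hb hm]
    omega
  · simp [hm]

theorem shape_extend_ne (h : IsSetPartition k P) (hb : b ∈ P) :
    shape (_root_.extend P b) ≠ shape (_root_.extend P ∅) := by
  intro heq
  have hlen := congrArg List.length heq
  rw [h.shape_extend_empty, h.shape_extend hb, h.shape_eq, List.length_cons,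
    length_nonzeroValues_congr fun m _ => h.sizeAt_add_eq_zero_iff hb m] at hlen
  omega

theorem extend_shape_injective (h : IsSetPartition k P) {c : Finset ℕ} (hb : b ∈ P ∨ b = ∅)
    (hc : c ∈ P ∨ c = ∅) (heq : shape (_root_.extend P b) = shape (_root_.extend P c)) :
    b = c := by
  rcases hb with hb | rfl <;> rcases hc with hc | rfl
  · obtain ⟨m, hmk, hm⟩ := h.exists_isMaxOf hb
    rw [h.shape_extend hb, h.shape_extend hc] at heq
    have key := eq_of_nonzeroValues_eq (fun m _ =>
      (h.sizeAt_add_eq_zero_iff hb m).trans (h.sizeAt_add_eq_zero_iff hc m).symm) heq m hmk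
    have hcm : IsMaxOf c m := by
      by_contra hcm
      simp [hm, hcm] at key
    exact h.eq_of_mem hb hc hm.1 hcm.1
  · exact absurd heq (h.shape_extend_ne hb)
  · exact absurd heq.symm (h.shape_extend_ne hc)
  · rfl

theorem exists_shape_extend_eq (h : IsSetPartition k P) {L : List ℕ} (hstep : Step (shape P) L) :
    ∃ b, (b ∈ P ∨ b = ∅) ∧ shape (_root_.extend P b) = L := by
  rcases hstep with rfl | ⟨⟨j, hj⟩, rfl⟩
  · exact ⟨∅, .inr rfl, h.shape_extend_empty⟩
  · simp only [h.shape_eq] at hj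
    obtain ⟨m, -, hm, hset⟩ := exists_nonzeroValues_eq_set List.nodup_range _ j hj
    obtain ⟨b, hb, hbm⟩ := exists_isMaxOf_of_sizeAt_ne_zero hm
    refine ⟨b, .inl hb, ?_⟩
    have hiff : ∀ x, IsMaxOf b x ↔ x = m := fun x =>
      ⟨fun hx => le_antisymm (hbm.2 x hx.1) (hx.2 m hbm.1), fun hx => hx ▸ hbm⟩
    simp only [h.shape_extend hb, hiff, hset, h.shape_eq, List.get_eq_getElem]

end IsSetPartition

/-- Given a set partition `Π` of `[k]` and a composition `Λ` of `k+1` with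
`shape(Π) → Λ`, there is a unique set partition `Θ` of `[k+1]` with
`Θ⁻ = Π` and `shape(Θ) = Λ`. -/
theorem existsUnique_partition_step (k : ℕ)
    (Pi : Finset (Finset ℕ)) (hPi : IsSetPartition k Pi)
    (Lam : List ℕ) (hpos : ∀ x ∈ Lam, 0 < x) (hsum : Lam.sum = k + 1)
    (hstep : Step (shape Pi) Lam) :
    ∃! Θ : Finset (Finset ℕ),
      IsSetPartition (k + 1) Θ ∧ pminus Θ = Pi ∧ shape Θ = Lam := by
  obtain ⟨b, hb, hshape⟩ := hPi.exists_shape_extend_eq hstep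
  refine ⟨extend Pi b, ⟨hPi.extend hb, hPi.pminus_extend hb, hshape⟩, ?_⟩
  rintro Θ ⟨hΘ, rfl, hΘshape⟩
  obtain ⟨c, hc, hΘc⟩ := hΘ.exists_eq_extend_pminus
  rw [hPi.extend_shape_injective hb hc (by rw [hshape, ← hΘc, hΘshape]), ← hΘc]
end

section
/- For every integer k ≥ 0 and every Dyck vector P = (p_1, …, p_k) of length k, the weighted count of strictly decreasing forests with exponent vector P satisfies Σ_{F ∈ Forests_{k∘}, P(F) = P} 2^{l_F − 1} = C_P, where C_P = ∏_{j=1}^k [ 2·binom(D_{P,j−1}, p_j − 1) + binom(D_{P,j−1}, p_j) ]. -/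
/-- A strictly decreasing (rooted labeled) forest on `Fin n`:
a partially defined father function such that each node's father is strictly
larger.  `f i = none` means `i` is a root. -/
def IsForest {n : ℕ} (f : Fin n → Option (Fin n)) : Prop :=
  ∀ i m, f i = some m → i < m

/-- Number of children of the node `m` in the forest `f`. -/
def nchild {n : ℕ} (f : Fin n → Option (Fin n)) (m : Fin n) : ℕ :=
  (Finset.univ.filter fun i => f i = some m).card

/-- Number of roots (trees) `l_F` of the forest `f`. -/
def nroots {n : ℕ} (f : Fin n → Option (Fin n)) : ℕ :=
  (Finset.univ.filter fun i => f i = none).card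

/-- The exponent vector of a forest on `[k] ∪ {∘}`.  Nodes are `Fin (k+1)`:
index `j < k` is the label `j+1`, and the last index is `∘` (the largest
element).  The entry `p_{j+1}` is `nchild j + 1` if `j` is a root, and
`nchild j` otherwise. -/
def pvec {k : ℕ} (f : Fin (k + 1) → Option (Fin (k + 1))) (j : Fin k) : ℕ :=
  nchild f j.castSucc + (if f j.castSucc = none then 1 else 0)

/-- A Dyck vector of length `k`: `p_1 + ⋯ + p_j ≤ j` for all `j ∈ {1,…,k}`. -/
def DyckVec {k : ℕ} (P : Fin k → ℕ) : Prop :=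
  ∀ j : Fin k, ∑ r ∈ Finset.univ.filter (· ≤ j), P r ≤ j.1 + 1

/-- `D_{P,j} = j − (p_1 + ⋯ + p_j)`. -/
def Dsum {k : ℕ} (P : Fin k → ℕ) (j : ℕ) : ℕ :=
  j - ∑ r ∈ Finset.univ.filter (fun r : Fin k => r.1 < j), P r

/-- The coefficient `C_P = ∏_{j=1}^k [2·binom(D_{P,j−1}, p_j − 1) + binom(D_{P,j−1}, p_j)]`,
with the convention `binom(m, −1) = 0` (handled by the `if`). -/
def CP {k : ℕ} (P : Fin k → ℕ) : ℕ :=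
  ∏ j : Fin k,
    (2 * (if P j = 0 then 0 else (Dsum P j.1).choose (P j - 1))
      + (Dsum P j.1).choose (P j))

/-- The pruned-and-grafted forest `F'` of a forest `F` on `[k+1] ∪ {∘}`:
detach all children of `∘` and attach them to the node `k+1`, then relabel
`k+1` as `∘`.  (Index `k` of `Fin (k+2)` is the label `k+1`; it becomes the
index `k`, i.e. the `∘`, of `Fin (k+1)`.) -/
def prune {k : ℕ} (f : Fin (k + 2) → Option (Fin (k + 2))) :
    Fin (k + 1) → Option (Fin (k + 1)) :=
  fun i =>
    if i.1 = k then none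
    else (f i.castSucc).map fun m => ⟨min m.1 k, by omega⟩


theorem nchild_eq_sum {n : ℕ} (f : Fin n → Option (Fin n)) (m : Fin n) :
    nchild f m = ∑ i, if f i = some m then 1 else 0 := by
  classical
  rw [nchild, Finset.card_filter]

theorem nroots_eq_sum {n : ℕ} (f : Fin n → Option (Fin n)) :
    nroots f = ∑ i, if f i = none then 1 else 0 := by
  classical
  rw [nroots, Finset.card_filter]

namespace IsForest

variable {k : ℕ}

theorem apply_last {f : Fin (k + 1) → Option (Fin (k + 1))} (hf : IsForest f) :
    f (Fin.last k) = none := by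
  rw [Option.eq_none_iff_forall_ne_some]
  intro m hm
  exact (hf _ _ hm).not_ge (Fin.le_last m)

theorem apply_castSucc_last {f : Fin (k + 2) → Option (Fin (k + 2))} (hf : IsForest f) :
    f (Fin.last k).castSucc = none ∨ f (Fin.last k).castSucc = some (Fin.last (k + 1)) := by
  cases h : f (Fin.last k).castSucc with
  | none => exact .inl rfl
  | some m =>
    have := hf _ _ h
    rw [Fin.lt_def] at this
    simp only [Fin.val_castSucc, Fin.val_last] at this
    right
    congr 1
    ext
    simp only [Fin.val_last]
    omega

theorem one_le_nroots {f : Fin (k + 1) → Option (Fin (k + 1))} (hf : IsForest f) :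
    1 ≤ nroots f := by
  rw [nroots_eq_sum, Fin.sum_univ_castSucc, if_pos hf.apply_last]
  omega

/-- The sum of the exponents and the number of children of `∘` is the number of other nodes. -/
theorem sum_pvec_add_nchild_last {f : Fin (k + 1) → Option (Fin (k + 1))} (hf : IsForest f) :
    ∑ j, pvec f j + nchild f (Fin.last k) = k := by
  have hcount : ∑ m, nchild f m + nroots f = k + 1 := by
    simp_rw [nchild_eq_sum, nroots_eq_sum]
    rw [Finset.sum_comm, ← Finset.sum_add_distrib]
    trans ∑ _i : Fin (k + 1), 1
    · refine Finset.sum_congr rfl fun i _ => ?_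
      cases f i <;> simp
    · simp
  rw [nroots_eq_sum, Fin.sum_univ_castSucc, Fin.sum_univ_castSucc, if_pos hf.apply_last] at hcount
  simp only [pvec, Finset.sum_add_distrib]
  omega

end IsForest

section Prune

variable {k : ℕ}

theorem prune_last (f : Fin (k + 2) → Option (Fin (k + 2))) : prune f (Fin.last k) = none := by
  simp [prune]

theorem prune_castSucc (f : Fin (k + 2) → Option (Fin (k + 2))) (i : Fin k) :
    prune f i.castSucc =
      (f i.castSucc.castSucc).map fun m => ⟨min m.1 k, by omega⟩ := by
  simp [prune, i.2.ne]

theorem IsForest.prune {f : Fin (k + 2) → Option (Fin (k + 2))} (hf : IsForest f) :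
    IsForest (prune f) := by
  intro i m
  refine Fin.lastCases ?_ (fun i => ?_) i
  · simp [prune_last]
  · rw [prune_castSucc, Option.map_eq_some_iff]
    rintro ⟨a, ha, rfl⟩
    have := hf _ _ ha
    rw [Fin.lt_def] at this ⊢
    have := i.2
    simp only [Fin.val_castSucc] at *
    omega

theorem prune_castSucc_eq_none {f : Fin (k + 2) → Option (Fin (k + 2))} {i : Fin k} :
    prune f i.castSucc = none ↔ f i.castSucc.castSucc = none := by
  simp [prune_castSucc]

theorem prune_castSucc_eq_some {f : Fin (k + 2) → Option (Fin (k + 2))} {i j : Fin k} :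
    prune f i.castSucc = some j.castSucc ↔ f i.castSucc.castSucc = some j.castSucc.castSucc := by
  rw [prune_castSucc, Option.map_eq_some_iff]
  constructor
  · rintro ⟨a, ha, h⟩
    rw [ha]
    have := j.2
    simp only [Fin.ext_iff, Fin.val_castSucc, Option.some.injEq] at h ⊢
    omega
  · intro h
    refine ⟨_, h, ?_⟩
    have := j.2
    simp only [Fin.ext_iff, Fin.val_castSucc]
    omega

theorem nchild_prune {f : Fin (k + 2) → Option (Fin (k + 2))} (hf : IsForest f) (j : Fin k) :
    nchild (prune f) j.castSucc = nchild f j.castSucc.castSucc := by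
  have hlast : f (Fin.last k).castSucc ≠ some j.castSucc.castSucc := fun h =>
    absurd (hf _ _ h) (by simp [Fin.lt_def, j.2.le])
  simp only [nchild_eq_sum, Fin.sum_univ_castSucc, hf.apply_last, prune_last, hlast,
    prune_castSucc_eq_some, reduceCtorEq, if_false]

theorem pvec_prune {f : Fin (k + 2) → Option (Fin (k + 2))} (hf : IsForest f) (j : Fin k) :
    pvec (prune f) j = pvec f j.castSucc := by
  simp only [pvec, nchild_prune hf, prune_castSucc_eq_none]

theorem nroots_eq_nroots_prune_add {f : Fin (k + 2) → Option (Fin (k + 2))} (hf : IsForest f) :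
    nroots f = nroots (prune f) + if f (Fin.last k).castSucc = none then 1 else 0 := by
  simp only [nroots_eq_sum, Fin.sum_univ_castSucc, hf.apply_last, prune_last,
    prune_castSucc_eq_none, if_true]
  omega

/-- The forest whose pruning is `g`, in which the largest node other than `∘` has image `c` and set
of children `S`. -/
def graft (g : Fin (k + 1) → Option (Fin (k + 1))) (c : Option (Fin (k + 2)))
    (S : Finset (Fin (k + 1))) : Fin (k + 2) → Option (Fin (k + 2)) :=
  Fin.lastCases none fun i =>
    if i = Fin.last k then c
    else if i ∈ S then some (Fin.last k).castSucc
    else (g i).map fun m => if m = Fin.last k then Fin.last (k + 1) else m.castSucc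

/-- The children, in a forest on `Fin (k + 2)`, of the second largest node. -/
def penultChildren (f : Fin (k + 2) → Option (Fin (k + 2))) : Finset (Fin (k + 1)) :=
  Finset.univ.filter fun i => f i.castSucc = some (Fin.last k).castSucc

theorem graft_last (g : Fin (k + 1) → Option (Fin (k + 1))) (c : Option (Fin (k + 2)))
    (S : Finset (Fin (k + 1))) : graft g c S (Fin.last (k + 1)) = none := by
  simp [graft]

theorem graft_castSucc (g : Fin (k + 1) → Option (Fin (k + 1))) (c : Option (Fin (k + 2)))
    (S : Finset (Fin (k + 1))) (i : Fin (k + 1)) :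
    graft g c S i.castSucc =
      if i = Fin.last k then c
      else if i ∈ S then some (Fin.last k).castSucc
      else (g i).map fun m => if m = Fin.last k then Fin.last (k + 1) else m.castSucc := by
  simp [graft]

theorem isForest_graft {g : Fin (k + 1) → Option (Fin (k + 1))} (hg : IsForest g)
    {c : Option (Fin (k + 2))} (hc : c = none ∨ c = some (Fin.last (k + 1)))
    (S : Finset (Fin (k + 1))) : IsForest (graft g c S) := by
  intro i m
  refine Fin.lastCases ?_ (fun i => ?_) i
  · simp [graft_last]
  rw [graft_castSucc]
  split_ifs with h₁ h₂
  · rintro rfl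
    simp only [reduceCtorEq, Option.some.injEq, false_or] at hc
    rw [hc]
    exact Fin.castSucc_lt_last i
  · rintro ⟨⟩
    rw [Fin.castSucc_lt_castSucc_iff]
    exact Fin.lt_last_iff_ne_last.2 h₁
  · rw [Option.map_eq_some_iff]
    rintro ⟨a, ha, rfl⟩
    split_ifs
    · exact Fin.castSucc_lt_last i
    · exact Fin.castSucc_lt_castSucc_iff.2 (hg _ _ ha)

theorem prune_graft {g : Fin (k + 1) → Option (Fin (k + 1))} (hg : IsForest g)
    {c : Option (Fin (k + 2))} {S : Finset (Fin (k + 1))}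
    (hS : ∀ i ∈ S, g i = some (Fin.last k)) : prune (graft g c S) = g := by
  funext i
  refine Fin.lastCases ?_ (fun i => ?_) i
  · rw [prune_last, hg.apply_last]
  rw [prune_castSucc, graft_castSucc, if_neg (Fin.castSucc_ne_last i)]
  split_ifs with h
  · rw [hS _ h]
    simp [Fin.ext_iff]
  · cases hm : g i.castSucc with
    | none => rfl
    | some m =>
      have := m.2
      simp only [Option.map_some, Option.some.injEq, Fin.ext_iff]
      split_ifs with h
      · simp [h]
      · simp only [Fin.val_castSucc]
        omega

theorem penultChildren_graft {g : Fin (k + 1) → Option (Fin (k + 1))} (hg : IsForest g)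
    {c : Option (Fin (k + 2))} (hc : c = none ∨ c = some (Fin.last (k + 1)))
    {S : Finset (Fin (k + 1))} (hS : ∀ i ∈ S, g i = some (Fin.last k)) :
    penultChildren (graft g c S) = S := by
  have hlast : Fin.last (k + 1) ≠ (Fin.last k).castSucc := (Fin.castSucc_lt_last _).ne'
  ext i
  simp only [penultChildren, Finset.mem_filter, Finset.mem_univ, true_and, graft_castSucc]
  split_ifs with h₁ h₂
  · subst h₁
    have : Fin.last k ∉ S := fun h => by simpa [hg.apply_last] using hS _ h
    rcases hc with rfl | rfl <;> simp [this, hlast]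
  · simp [h₂]
  · simp only [h₂, iff_false, Option.map_eq_some_iff, not_exists, not_and]
    intro a _
    split_ifs with h
    · exact hlast
    · simpa using h

theorem graft_prune_penultChildren {f : Fin (k + 2) → Option (Fin (k + 2))} (hf : IsForest f) :
    graft (prune f) (f (Fin.last k).castSucc) (penultChildren f) = f := by
  funext i
  refine Fin.lastCases ?_ (fun i => ?_) i
  · rw [graft_last, hf.apply_last]
  rw [graft_castSucc]
  refine Fin.lastCases (by simp) (fun i => ?_) i
  simp only [Fin.castSucc_ne_last, if_false, penultChildren, Finset.mem_filter, Finset.mem_univ,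
    true_and]
  split_ifs with h
  · exact h.symm
  rw [prune_castSucc]
  cases hm : f i.castSucc.castSucc with
  | none => rfl
  | some m =>
    rw [hm, Option.some.injEq, Fin.ext_iff] at h
    have := m.2
    simp only [Fin.val_castSucc, Fin.val_last] at h
    simp only [Option.map_some, Option.some.injEq, Fin.ext_iff, Fin.val_last]
    split_ifs <;> simp only [Fin.val_castSucc, Fin.val_last] <;> omega

theorem card_penultChildren {f : Fin (k + 2) → Option (Fin (k + 2))} (hf : IsForest f) :
    (penultChildren f).card = nchild f (Fin.last k).castSucc := by
  rw [penultChildren, nchild_eq_sum, Finset.card_filter, Fin.sum_univ_castSucc (n := k + 1)]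
  simp [hf.apply_last]

theorem prune_eq_some_last_of_mem_penultChildren {f : Fin (k + 2) → Option (Fin (k + 2))}
    (hf : IsForest f) {i : Fin (k + 1)} (hi : i ∈ penultChildren f) :
    prune f i = some (Fin.last k) := by
  simp only [penultChildren, Finset.mem_filter, Finset.mem_univ, true_and] at hi
  have hlt := hf _ _ hi
  rw [Fin.castSucc_lt_castSucc_iff] at hlt
  have hne : i.1 ≠ k := (Fin.lt_def.1 hlt).ne
  simp [prune, hi, Fin.ext_iff, hne]

open Classical in
/-- The number of forests with a given pruning `g`, a given image of the grafted node and a given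
number of children of it. -/
theorem card_forests_prune_eq {g : Fin (k + 1) → Option (Fin (k + 1))} (hg : IsForest g)
    {c : Option (Fin (k + 2))} (hc : c = none ∨ c = some (Fin.last (k + 1))) (p : ℕ) :
    (Finset.univ.filter fun f : Fin (k + 2) → Option (Fin (k + 2)) =>
      IsForest f ∧ prune f = g ∧ f (Fin.last k).castSucc = c ∧
        nchild f (Fin.last k).castSucc = p).card = (nchild g (Fin.last k)).choose p := by
  rw [nchild, ← Finset.card_powersetCard]
  refine Finset.card_nbij' penultChildren (graft g c) ?_ ?_ ?_ ?_
  · simp only [Set.MapsTo, Finset.mem_coe, Finset.mem_filter, Finset.mem_univ, true_and,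
      Finset.mem_powersetCard]
    rintro f ⟨hf, rfl, rfl, rfl⟩
    refine ⟨fun i hi => ?_, card_penultChildren hf⟩
    simpa using prune_eq_some_last_of_mem_penultChildren hf hi
  · simp only [Set.MapsTo, Finset.mem_coe, Finset.mem_filter, Finset.mem_univ, true_and,
      Finset.mem_powersetCard]
    rintro S ⟨hS, rfl⟩
    replace hS : ∀ i ∈ S, g i = some (Fin.last k) := fun i hi => by simpa using hS hi
    have hf := isForest_graft hg hc S
    refine ⟨hf, prune_graft hg hS, by simp [graft_castSucc], ?_⟩
    rw [← card_penultChildren hf, penultChildren_graft hg hc hS]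
  · simp only [Set.LeftInvOn, Finset.mem_coe, Finset.mem_filter, Finset.mem_univ, true_and]
    rintro f ⟨hf, rfl, rfl, -⟩
    exact graft_prune_penultChildren hf
  · simp only [Set.RightInvOn, Set.LeftInvOn, Finset.mem_coe, Finset.mem_powersetCard]
    rintro S ⟨hS, -⟩
    exact penultChildren_graft hg hc fun i hi => by simpa using hS hi

open Classical in
/-- The weighted count of the forests with a given pruning `g` and a given exponent of the grafted
node. -/
theorem sum_forests_prune_eq {g : Fin (k + 1) → Option (Fin (k + 1))} (hg : IsForest g) (p : ℕ) :
    ∑ f ∈ Finset.univ.filter (fun f : Fin (k + 2) → Option (Fin (k + 2)) =>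
        IsForest f ∧ prune f = g ∧ pvec f (Fin.last k) = p), 2 ^ (nroots f - 1) =
      2 ^ (nroots g - 1) *
        (2 * (if p = 0 then 0 else (nchild g (Fin.last k)).choose (p - 1))
          + (nchild g (Fin.last k)).choose p) := by
  have hroots := hg.one_le_nroots
  rw [← Finset.sum_filter_add_sum_filter_not _ fun f => f (Fin.last k).castSucc = none, mul_add]
  congr 1
  · split_ifs with hp
    · rw [mul_zero, mul_zero]
      refine Finset.sum_eq_zero fun f hf => ?_
      obtain ⟨hf, h'⟩ := Finset.mem_filter.1 hf
      obtain ⟨-, -, -, h⟩ := Finset.mem_filter.1 hf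
      rw [pvec, if_pos h'] at h
      omega
    · rw [← card_forests_prune_eq hg (.inl rfl), ← mul_assoc, ← pow_succ, Finset.filter_filter,
        mul_comm, ← smul_eq_mul, ← Finset.sum_const]
      refine Finset.sum_congr (Finset.filter_congr fun f _ => ?_) fun f => ?_
      · constructor
        · rintro ⟨⟨hf, hfg, h⟩, h'⟩
          rw [pvec, if_pos h'] at h
          exact ⟨hf, hfg, h', by omega⟩
        · rintro ⟨hf, hfg, h', h⟩
          refine ⟨⟨hf, hfg, ?_⟩, h'⟩
          rw [pvec, if_pos h']
          omega
      · simp only [Finset.mem_filter]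
        rintro ⟨-, hf, rfl, h, -⟩
        rw [nroots_eq_nroots_prune_add hf, if_pos h]
        congr 1
        omega
  · rw [← card_forests_prune_eq hg (.inr rfl), Finset.filter_filter,
      mul_comm, ← smul_eq_mul, ← Finset.sum_const]
    refine Finset.sum_congr (Finset.filter_congr fun f _ => ?_) fun f => ?_
    · constructor
      · rintro ⟨⟨hf, hfg, h⟩, h'⟩
        rw [pvec, if_neg h', add_zero] at h
        exact ⟨hf, hfg, hf.apply_castSucc_last.resolve_left h', h⟩
      · rintro ⟨hf, hfg, h', h⟩
        have hne : f (Fin.last k).castSucc ≠ none := by simp [h']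
        refine ⟨⟨hf, hfg, ?_⟩, hne⟩
        rw [pvec, if_neg hne, add_zero, h]
    · simp only [Finset.mem_filter]
      rintro ⟨-, hf, rfl, h, -⟩
      rw [nroots_eq_nroots_prune_add hf, if_neg (by simp [h]), add_zero]

end Prune

section Dyck

variable {k : ℕ}

theorem Dsum_castSucc (P : Fin (k + 1) → ℕ) {j : ℕ} (hj : j ≤ k) :
    Dsum P j = Dsum (fun i : Fin k => P i.castSucc) j := by
  simp [Dsum, Finset.sum_filter, Fin.sum_univ_castSucc, hj.not_gt]

theorem CP_succ (P : Fin (k + 1) → ℕ) :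
    CP P = CP (fun i : Fin k => P i.castSucc) *
      (2 * (if P (Fin.last k) = 0 then 0 else (Dsum P k).choose (P (Fin.last k) - 1))
        + (Dsum P k).choose (P (Fin.last k))) := by
  rw [CP, Fin.prod_univ_castSucc, CP]
  congr 1
  refine Finset.prod_congr rfl fun i _ => ?_
  rw [Fin.val_castSucc, Dsum_castSucc P i.2.le]

theorem DyckVec.castSucc {P : Fin (k + 1) → ℕ} (hP : DyckVec P) :
    DyckVec fun i : Fin k => P i.castSucc := by
  intro j
  have := hP j.castSucc
  have hj : ¬ Fin.last k ≤ j.castSucc := (Fin.castSucc_lt_last j).not_ge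
  simpa [Finset.sum_filter, Fin.sum_univ_castSucc, hj] using this

theorem IsForest.nchild_last_eq_Dsum {g : Fin (k + 1) → Option (Fin (k + 1))} (hg : IsForest g)
    {P : Fin (k + 1) → ℕ} (h : ∀ j, pvec g j = P j.castSucc) :
    nchild g (Fin.last k) = Dsum P k := by
  have hsum := hg.sum_pvec_add_nchild_last
  simp_rw [h] at hsum
  rw [Dsum_castSucc P le_rfl, Dsum, Finset.filter_true_of_mem fun i _ => i.2]
  omega

end Dyck

open Classical in
/-- For every Dyck vector `P` of length `k`, the weighted count of strictly
decreasing forests on `[k] ∪ {∘}` with exponent vector `P` is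
`Σ_{F : P(F) = P} 2^(l_F − 1) = C_P`. -/
theorem weighted_forest_count (k : ℕ) (P : Fin k → ℕ) (hP : DyckVec P) :
    ∑ f ∈ Finset.univ.filter
        (fun f : Fin (k + 1) → Option (Fin (k + 1)) =>
          IsForest f ∧ ∀ j : Fin k, pvec f j = P j),
      2 ^ (nroots f - 1) = CP P := by
  induction k with
  | zero =>
    have huniv : (Finset.univ.filter fun f : Fin (0 + 1) → Option (Fin (0 + 1)) =>
        IsForest f ∧ ∀ j : Fin 0, pvec f j = P j) = {fun _ => none} := by
      ext f
      simp only [Finset.mem_filter, Finset.mem_univ, true_and, Finset.mem_singleton]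
      constructor
      · rintro ⟨hf, -⟩
        funext i
        rw [show i = Fin.last 0 from Fin.ext (by omega), hf.apply_last]
      · rintro rfl
        exact ⟨fun i m h => by simp at h, fun j => j.elim0⟩
    rw [huniv]
    simp [nroots, CP]
  | succ k ih =>
    rw [CP_succ, ← ih _ hP.castSucc, Finset.sum_mul]
    rw [← Finset.sum_fiberwise_of_maps_to (g := prune)
      (t := Finset.univ.filter fun g : Fin (k + 1) → Option (Fin (k + 1)) =>
        IsForest g ∧ ∀ j : Fin k, pvec g j = P j.castSucc)]
    · refine Finset.sum_congr rfl fun g hg => ?_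
      simp only [Finset.mem_filter, Finset.mem_univ, true_and] at hg
      obtain ⟨hg, hgP⟩ := hg
      rw [← hg.nchild_last_eq_Dsum hgP, ← sum_forests_prune_eq hg, Finset.filter_filter]
      refine Finset.sum_congr (Finset.filter_congr fun f _ => ?_) fun _ _ => rfl
      constructor
      · rintro ⟨⟨hf, hfP⟩, hfg⟩
        exact ⟨hf, hfg, hfP _⟩
      · rintro ⟨hf, rfl, hlast⟩
        refine ⟨⟨hf, fun j => ?_⟩, rfl⟩
        refine Fin.lastCases hlast (fun j => ?_) j
        rw [← pvec_prune hf, hgP]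
    · intro f
      simp only [Finset.mem_filter, Finset.mem_univ, true_and]
      rintro ⟨hf, hfP⟩
      exact ⟨hf.prune, fun j => by rw [pvec_prune hf, hfP]⟩
end
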